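/- arXiv:2505.15279 — 2 statements merged into one kernel-verified Lean document; each statement's English description precedes it below -/
import Mathlib

section
/- Let N be a positive integer, R₀ and R₁ Hermitian positive semidefinite N×N complex matrices, and g₀ ∈ ℂᴺ with g₀ᴴ R₀ g₀ ≠ 0. Define R₀* = (1/(g₀ᴴ R₀ g₀)) · R₀ g₀ g₀ᴴ R₀ and R₁* = R₀ + R₁ − R₀*. Then R₁* − R₁ is positive semidefinite, R₁* is positive semidefinite, and R₀* + R₁* = R₀ + R₁. -/
open Matrix ComplexOrder

/-- For Hermitian positive semidefinite `N×N` complex matrices `R₀, R₁` and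
`g₀ ∈ ℂᴺ` with `g₀ᴴ R₀ g₀ ≠ 0`, defining `R₀* = (1/(g₀ᴴ R₀ g₀)) · R₀ g₀ g₀ᴴ R₀` and
`R₁* = R₀ + R₁ − R₀*`, one has `R₁* − R₁ ⪰ 0`, `R₁* ⪰ 0`, and `R₀* + R₁* = R₀ + R₁`. -/
theorem an_covariance_reconstruction {N : ℕ} (hN : 0 < N)
    (R₀ R₁ : Matrix (Fin N) (Fin N) ℂ)
    (hR₀ : R₀.PosSemidef) (hR₁ : R₁.PosSemidef)
    (g₀ : Fin N → ℂ) (hg₀ : star g₀ ⬝ᵥ R₀.mulVec g₀ ≠ 0)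
    (R₀s R₁s : Matrix (Fin N) (Fin N) ℂ)
    (hR₀s : R₀s = (star g₀ ⬝ᵥ R₀.mulVec g₀)⁻¹ •
        (R₀ * Matrix.vecMulVec g₀ (star g₀) * R₀))
    (hR₁s : R₁s = R₀ + R₁ - R₀s) :
    (R₁s - R₁).PosSemidef ∧ R₁s.PosSemidef ∧ R₀s + R₁s = R₀ + R₁ := by
  have hc : star (star g₀ ⬝ᵥ R₀.mulVec g₀) = star g₀ ⬝ᵥ R₀.mulVec g₀ := by
    have h := hR₀.dotProduct_mulVec_nonneg g₀
    exact (IsSelfAdjoint.of_nonneg h).star_eq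
  have hGRG : vecMulVec g₀ (star g₀) * R₀ * vecMulVec g₀ (star g₀) =
      (star g₀ ⬝ᵥ R₀.mulVec g₀) • vecMulVec g₀ (star g₀) := by
    rw [Matrix.mul_assoc, Matrix.mul_vecMulVec, Matrix.vecMulVec_mul_vecMulVec,
      Matrix.vecMulVec_smul]
  have hG : (vecMulVec g₀ (star g₀))ᴴ = vecMulVec g₀ (star g₀) := by
    rw [Matrix.conjTranspose_vecMulVec, star_star]
  generalize star g₀ ⬝ᵥ R₀.mulVec g₀ = c at *
  generalize vecMulVec g₀ (star g₀) = G at *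
  have key : (R₀ - R₀s).PosSemidef := by
    have h := hR₀.conjTranspose_mul_mul_same (1 - c⁻¹ • (G * R₀))
    have e : (1 - c⁻¹ • (G * R₀))ᴴ * R₀ * (1 - c⁻¹ • (G * R₀)) = R₀ - R₀s := by
      have h5 : R₀ * G * R₀ * (G * R₀) = c • (R₀ * G * R₀) := by
        calc R₀ * G * R₀ * (G * R₀) = R₀ * (G * R₀ * G) * R₀ := by
              simp only [Matrix.mul_assoc]
          _ = _ := by rw [hGRG]; simp
      rw [conjTranspose_sub, conjTranspose_smul, conjTranspose_mul, hG, hR₀.isHermitian.eq,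
        conjTranspose_one, star_inv₀, hc, hR₀s]
      simp only [sub_mul, mul_sub, one_mul, mul_one, smul_mul_assoc, mul_smul_comm, h5,
        smul_smul, ← Matrix.mul_assoc]
      simp [hg₀]
    rwa [e] at h
  have e1 : R₁s - R₁ = R₀ - R₀s := by rw [hR₁s]; abel
  have e2 : R₁s = (R₀ - R₀s) + R₁ := by rw [hR₁s]; abel
  refine ⟨e1 ▸ key, e2 ▸ key.add hR₁, by rw [hR₁s]; abel⟩
end

section
/- Let N be a positive integer, R₀ and R₁ Hermitian positive semidefinite N×N complex matrices, g₀ ∈ ℂᴺ with g₀ᴴ R₀ g₀ ≠ 0, and σ² > 0 a real number. Define R₀* = (1/(g₀ᴴ R₀ g₀)) · R₀ g₀ g₀ᴴ R₀ and R₁* = R₀ + R₁ − R₀*. Then for every vector g ∈ ℂᴺ, (gᴴ R₀* g)/(gᴴ R₁* g + σ²) ≤ (gᴴ R₀ g)/(gᴴ R₁ g + σ²). -/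
open Matrix ComplexOrder

/-- For Hermitian positive semidefinite `N×N` complex matrices `R₀, R₁`,
`g₀ ∈ ℂᴺ` with `g₀ᴴ R₀ g₀ ≠ 0`, and noise power `σ² > 0`, with
`R₀* = (1/(g₀ᴴ R₀ g₀)) · R₀ g₀ g₀ᴴ R₀` and `R₁* = R₀ + R₁ − R₀*`, every channel `g ∈ ℂᴺ`
satisfies `(gᴴ R₀* g)/(gᴴ R₁* g + σ²) ≤ (gᴴ R₀ g)/(gᴴ R₁ g + σ²)`. -/
theorem sinr_not_increased_at_eavesdroppers {N : ℕ} (hN : 0 < N)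
    (R₀ R₁ : Matrix (Fin N) (Fin N) ℂ)
    (hR₀ : R₀.PosSemidef) (hR₁ : R₁.PosSemidef)
    (g₀ : Fin N → ℂ) (hg₀ : star g₀ ⬝ᵥ R₀.mulVec g₀ ≠ 0)
    (σsq : ℝ) (hσ : 0 < σsq)
    (R₀s R₁s : Matrix (Fin N) (Fin N) ℂ)
    (hR₀s : R₀s = (star g₀ ⬝ᵥ R₀.mulVec g₀)⁻¹ •
        (R₀ * Matrix.vecMulVec g₀ (star g₀) * R₀))
    (hR₁s : R₁s = R₀ + R₁ - R₀s) :
    ∀ g : Fin N → ℂ,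
      (star g ⬝ᵥ R₀s.mulVec g).re / ((star g ⬝ᵥ R₁s.mulVec g).re + σsq) ≤
        (star g ⬝ᵥ R₀.mulVec g).re / ((star g ⬝ᵥ R₁.mulVec g).re + σsq) := by
  intro g
  have hA := hR₀.dotProduct_mulVec_nonneg g
  have hB := hR₁.dotProduct_mulVec_nonneg g
  have hsym : star g ⬝ᵥ R₀.mulVec g₀ = star (star g₀ ⬝ᵥ R₀.mulVec g) := by
    rw [← star_dotProduct_star, star_star, star_mulVec, hR₀.1.eq, dotProduct_comm,
      ← dotProduct_mulVec, dotProduct_comm]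
  have hc := hR₀.dotProduct_mulVec_nonneg g₀
  have hX : star g ⬝ᵥ R₀s.mulVec g = (star g₀ ⬝ᵥ R₀.mulVec g₀)⁻¹ *
      (star (star g₀ ⬝ᵥ R₀.mulVec g) * (star g₀ ⬝ᵥ R₀.mulVec g)) := by
    rw [← hsym, hR₀s, smul_mulVec, dotProduct_smul, smul_eq_mul, ← mulVec_mulVec,
      ← mulVec_mulVec, vecMulVec_mulVec, mulVec_smul, dotProduct_smul]
    simp
  have hx := hR₀.dotProduct_mulVec_nonneg
    (g - ((star g₀ ⬝ᵥ R₀.mulVec g₀)⁻¹ * (star g₀ ⬝ᵥ R₀.mulVec g)) • g₀)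
  have hY : (star g ⬝ᵥ R₁s.mulVec g) = star g ⬝ᵥ R₀.mulVec g + star g ⬝ᵥ R₁.mulVec g
      - star g ⬝ᵥ R₀s.mulVec g := by
    rw [hR₁s, sub_mulVec, add_mulVec, dotProduct_sub, dotProduct_add]
  have hcs : star (star g₀ ⬝ᵥ R₀.mulVec g₀) = star g₀ ⬝ᵥ R₀.mulVec g₀ :=
    (IsSelfAdjoint.of_nonneg hc).star_eq
  have hle : star g ⬝ᵥ R₀s.mulVec g ≤ star g ⬝ᵥ R₀.mulVec g := by
    rw [← sub_nonneg]
    convert hx using 1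
    rw [hX, mulVec_sub, mulVec_smul, star_sub, star_smul, sub_dotProduct, dotProduct_sub,
      dotProduct_sub, smul_dotProduct, smul_dotProduct, dotProduct_smul, dotProduct_smul, hsym,
      star_mul', star_inv₀, hcs]
    simp only [smul_eq_mul]
    field_simp
    ring
  rw [hY]
  have h1 := (Complex.le_def.1 hle).1
  have h2 := (Complex.le_def.1 hA).1
  have h3 := (Complex.le_def.1 hB).1
  simp only [Complex.sub_re, Complex.add_re, Complex.zero_re] at *
  exact div_le_div₀ h2 h1 (by linarith) (by linarith)
end
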